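/- Every dense subgroup G of PSL₂(ℝ) contains an elliptic element of infinite order. -/

import Mathlib

open Matrix

/-- The topology on `SL(2,ℝ)` as a subspace of the matrices. -/
noncomputable instance : TopologicalSpace (SpecialLinearGroup (Fin 2) ℝ) :=
  inferInstanceAs (TopologicalSpace {A : Matrix (Fin 2) (Fin 2) ℝ // A.det = 1})

/-- `PSL₂(ℝ) = SL₂(ℝ)/center`, with its quotient (standard Lie group) topology. -/
abbrev PSL2R : Type :=
  SpecialLinearGroup (Fin 2) ℝ ⧸ Subgroup.center (SpecialLinearGroup (Fin 2) ℝ)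

/-- An element of `PSL₂(ℝ)` is elliptic if some (hence any) lift to `SL₂(ℝ)` has trace
of absolute value `< 2`; equivalently it fixes a point of `ℍ²`. -/
def IsElliptic (g : PSL2R) : Prop :=
  ∃ A : SpecialLinearGroup (Fin 2) ℝ, (QuotientGroup.mk A : PSL2R) = g ∧ |Matrix.trace A.1| < 2

open Polynomial in
/-- A complex root of `dickson 1 1 m - 2` is a sum of a root of unity and its inverse. -/
theorem Complex.isIntegral_and_norm_le_two_of_eval_dickson {z : ℂ} {m : ℕ} (hm : m ≠ 0)
    (hz : (dickson 1 (1 : ℂ) m).eval z = 2) : IsIntegral ℤ z ∧ ‖z‖ ≤ 2 := by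
  obtain ⟨w, hw⟩ := IsAlgClosed.exists_root (X ^ 2 - C z * X + 1 : ℂ[X]) (by
    have : (X ^ 2 - C z * X + 1 : ℂ[X]).degree = 2 := by compute_degree!
    simp [this])
  have hw' : w * (z - w) = 1 := by
    simp only [IsRoot.def, eval_add, eval_sub, eval_pow, eval_X, eval_mul, eval_C, eval_one] at hw
    linear_combination -hw
  have hsum : w ^ m + (z - w) ^ m = 2 := by
    rw [← dickson_one_one_eval_add_inv w (z - w) hw' m, ← hz]
    ring_nf
  have hprod : w ^ m * (z - w) ^ m = 1 := by rw [← mul_pow, hw', one_pow]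
  have hwm : w ^ m = 1 := by
    have : (w ^ m - 1) ^ 2 = 0 := by linear_combination w ^ m * hsum - hprod
    exact sub_eq_zero.mp (pow_eq_zero_iff two_ne_zero |>.mp this)
  have hvm : (z - w) ^ m = 1 := by simpa [hwm] using hprod
  constructor
  · have h := (IsIntegral.of_pow (R := ℤ) (Nat.pos_of_ne_zero hm) (hwm ▸ isIntegral_one)).add
      (IsIntegral.of_pow (R := ℤ) (Nat.pos_of_ne_zero hm) (hvm ▸ isIntegral_one))
    simpa using h
  · calc ‖z‖ = ‖w + (z - w)‖ := by ring_nf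
      _ ≤ ‖w‖ + ‖z - w‖ := norm_add_le _ _
      _ = 2 := by
        rw [Complex.norm_eq_one_of_pow_eq_one hwm hm, Complex.norm_eq_one_of_pow_eq_one hvm hm]
        norm_num

open Polynomial in
theorem eval_map_dickson_one_one {R S : Type*} [CommRing R] [CommRing S] (f : R →+* S) (m : ℕ)
    (x : R) : (dickson 1 (1 : S) m).eval (f x) = f ((dickson 1 (1 : R) m).eval x) := by
  rw [← f.map_one, ← map_dickson, eval_map_apply]

open Polynomial in
theorem NumberField.finite_setOf_eval_dickson (K : Type*) [Field K] [NumberField K] :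
    {x : K | ∃ m : ℕ, m ≠ 0 ∧ (dickson 1 (1 : K) m).eval x = 2}.Finite := by
  refine (NumberField.Embeddings.finite_of_norm_le K ℂ 2).subset ?_
  rintro x ⟨m, hm, hx⟩
  have key (φ : K →+* ℂ) :=
    Complex.isIntegral_and_norm_le_two_of_eval_dickson hm
      ((eval_map_dickson_one_one φ m x).trans (by rw [hx, map_ofNat]))
  obtain ⟨φ⟩ : Nonempty (K →+* ℂ) := inferInstance
  exact ⟨(isIntegral_algHom_iff φ.toIntAlgHom φ.injective).mp (key φ).1, fun φ => (key φ).2⟩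

open Polynomial in
theorem Real.isIntegral_of_eval_dickson {x : ℝ} {m : ℕ} (hm : m ≠ 0)
    (hx : (dickson 1 (1 : ℝ) m).eval x = 2) : IsIntegral ℤ x :=
  (isIntegral_algHom_iff Complex.ofRealHom.toIntAlgHom Complex.ofRealHom.injective).mp
    (Complex.isIntegral_and_norm_le_two_of_eval_dickson hm
      ((eval_map_dickson_one_one Complex.ofRealHom m x).trans (by rw [hx, map_ofNat]))).1

namespace Matrix.SpecialLinearGroup

section CommRing

variable {R : Type*} [CommRing R]

open Polynomial in
theorem trace_pow (A : SpecialLinearGroup (Fin 2) R) (n : ℕ) :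
    trace (A.1 ^ n) = (dickson 1 (1 : R) n).eval (trace A.1) := by
  have hA : A.1 ^ 2 = trace A.1 • A.1 - 1 := by
    have hdet := A.2
    rw [det_fin_two] at hdet
    ext i j
    fin_cases i <;> fin_cases j <;>
      simp [pow_two, mul_apply, Fin.sum_univ_two, trace_fin_two] <;> grind
  induction n using Nat.twoStepInduction with
  | zero => simp; norm_num
  | one => simp
  | more n h₀ h₁ =>
    have : A.1 ^ (n + 2) = trace A.1 • A.1 ^ (n + 1) - A.1 ^ n := by
      rw [pow_add, hA, mul_sub, mul_smul_comm, mul_one, pow_succ]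
    simp [this, dickson_add_two, h₀, h₁]

theorem trace_mul_conj (A C : SpecialLinearGroup (Fin 2) R) :
    trace (A * (C * A * C⁻¹)).1 =
      trace (A * C).1 * (trace A.1 * trace C.1 - trace (A * C).1) - trace C.1 ^ 2 + 2 := by
  have hA := A.2
  have hC := C.2
  rw [det_fin_two] at hA hC
  simp only [coe_mul, coe_inv, adjugate_fin_two, trace_fin_two, mul_apply, Fin.sum_univ_two,
    of_apply, cons_val', cons_val_zero, cons_val_one, cons_val_fin_one]
  linear_combination (-((C.1 0 0 + C.1 1 1) ^ 2 - 2 * (C.1 0 0 * C.1 1 1 - C.1 0 1 * C.1 1 0))) * hA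
    + 2 * hC

theorem trace_conj (A C : SpecialLinearGroup (Fin 2) R) :
    trace (C * A * C⁻¹).1 = trace A.1 := by
  rw [coe_mul, trace_mul_comm, ← coe_mul, ← mul_assoc, inv_mul_cancel, one_mul]

/-- The sequence `B`, `B A B⁻¹`, … in which each term conjugates `A` by the previous term. -/
def iterConj (A B : SpecialLinearGroup (Fin 2) R) : ℕ → SpecialLinearGroup (Fin 2) R
  | 0 => B * A * B⁻¹
  | n + 1 => iterConj A B n * A * (iterConj A B n)⁻¹

theorem trace_iterConj (A B : SpecialLinearGroup (Fin 2) R) (n : ℕ) :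
    trace (iterConj A B n).1 = trace A.1 := by
  cases n <;> exact trace_conj _ _

theorem trace_mul_iterConj_succ (A B : SpecialLinearGroup (Fin 2) R) (n : ℕ) :
    trace (A * iterConj A B (n + 1)).1 =
      trace (A * iterConj A B n).1 * (trace A.1 ^ 2 - trace (A * iterConj A B n).1)
        - trace A.1 ^ 2 + 2 := by
  rw [iterConj, trace_mul_conj, trace_iterConj]
  ring

theorem iterConj_mem {A B : SpecialLinearGroup (Fin 2) R}
    {H : Subgroup (SpecialLinearGroup (Fin 2) R)} (hA : A ∈ H) (hB : B ∈ H) (n : ℕ) :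
    iterConj A B n ∈ H := by
  induction n with
  | zero => exact H.mul_mem (H.mul_mem hB hA) (H.inv_mem hB)
  | succ n ih => exact H.mul_mem (H.mul_mem ih hA) (H.inv_mem ih)

end CommRing

open Polynomial in
theorem eval_dickson_trace_of_isOfFinOrder_mk {A : SpecialLinearGroup (Fin 2) ℝ}
    (hA : IsOfFinOrder (QuotientGroup.mk A : PSL2R)) :
    ∃ m : ℕ, m ≠ 0 ∧ (dickson 1 (1 : ℝ) m).eval (trace A.1) = 2 := by
  obtain ⟨n, hn, h⟩ := isOfFinOrder_iff_pow_eq_one.mp hA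
  rw [← QuotientGroup.mk_pow, QuotientGroup.eq_one_iff, mem_center_iff] at h
  obtain ⟨r, hr, hrA⟩ := h
  refine ⟨n * 2, by omega, ?_⟩
  rw [Fintype.card_fin] at hr
  rw [← trace_pow, pow_mul, ← coe_pow, ← hrA, ← map_pow, hr, map_one, trace_one]
  simp

theorem continuous_val_real :
    Continuous (fun A : SpecialLinearGroup (Fin 2) ℝ => A.1) :=
  continuous_subtype_val

theorem continuous_mul_left_real (B : SpecialLinearGroup (Fin 2) ℝ) :
    Continuous (fun A : SpecialLinearGroup (Fin 2) ℝ => B * A) :=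
  Continuous.subtype_mk (continuous_const.matrix_mul continuous_val_real) _

theorem continuous_mul_right_real (B : SpecialLinearGroup (Fin 2) ℝ) :
    Continuous (fun A : SpecialLinearGroup (Fin 2) ℝ => A * B) :=
  Continuous.subtype_mk (continuous_val_real.matrix_mul continuous_const) _

instance : SeparatelyContinuousMul (SpecialLinearGroup (Fin 2) ℝ) where
  continuous_const_mul := continuous_mul_left_real _
  continuous_mul_const := continuous_mul_right_real _

theorem continuous_trace_mul_conj (A : SpecialLinearGroup (Fin 2) ℝ) :
    Continuous (fun B : SpecialLinearGroup (Fin 2) ℝ => trace (A * (B * A * B⁻¹)).1) := by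
  have h := continuous_val_real
  simp only [coe_mul, coe_inv]
  exact (continuous_const.matrix_mul
    ((h.matrix_mul continuous_const).matrix_mul h.matrix_adjugate)).matrix_trace

/-- Conjugating an elliptic matrix by a suitable small translation. -/
theorem exists_trace_mul_conj_eq {A : SpecialLinearGroup (Fin 2) ℝ} (hA : trace A.1 ^ 2 < 4)
    {p : ℝ} (hp : 0 ≤ p) :
    ∃ B : SpecialLinearGroup (Fin 2) ℝ, trace (A * (B * A * B⁻¹)).1 = trace A.1 ^ 2 - 2 - p := by
  have hdet := A.2
  rw [det_fin_two] at hdet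
  rw [trace_fin_two] at hA ⊢
  have hc : A.1 1 0 ≠ 0 := fun h => by
    rw [h] at hdet
    nlinarith [sq_nonneg (A.1 0 0 - A.1 1 1)]
  obtain ⟨B, hB⟩ : ∃ B : SpecialLinearGroup (Fin 2) ℝ, B.1 = !![1, √p / A.1 1 0; 0, 1] :=
    ⟨⟨_, by simp [det_fin_two]⟩, rfl⟩
  refine ⟨B, ?_⟩
  have hw : (√p / A.1 1 0 * A.1 1 0) ^ 2 = p := by rw [div_mul_cancel₀ _ hc, Real.sq_sqrt hp]
  simp only [coe_mul, coe_inv, hB, adjugate_fin_two, trace_fin_two, mul_apply,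
    Fin.sum_univ_two, of_apply, cons_val', cons_val_zero, cons_val_one, cons_val_fin_one]
  linear_combination -hw - 2 * hdet

/-- An explicit matrix in `SL(2,ℝ)` of given trace. -/
theorem exists_trace_eq (t : ℝ) : ∃ A : SpecialLinearGroup (Fin 2) ℝ, trace A.1 = t :=
  ⟨⟨!![t, -1; 1, 0], by simp [det_fin_two]⟩, by simp [trace_fin_two]⟩

end Matrix.SpecialLinearGroup

theorem mem_Ioo_and_strictMono_of_trace_recursion {x : ℝ} (hx : 15 / 4 < x ^ 2) (hx' : x ^ 2 < 4)
    {u : ℕ → ℝ} (h₀ : u 0 ∈ Set.Ioo (x ^ 2 - 9 / 4) (x ^ 2 - 2))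
    (hu : ∀ n, u (n + 1) = u n * (x ^ 2 - u n) - x ^ 2 + 2) :
    (∀ n, u n ∈ Set.Ioo (x ^ 2 - 9 / 4) (x ^ 2 - 2)) ∧ StrictMono u := by
  have hrec (n : ℕ) : x ^ 2 - 2 - u (n + 1) =
      (x ^ 2 - 2 - u n) * (4 - x ^ 2 + (x ^ 2 - 2 - u n)) := by
    rw [hu]; ring
  have hstep (n : ℕ) (h : u n ∈ Set.Ioo (x ^ 2 - 9 / 4) (x ^ 2 - 2)) :
      u n < u (n + 1) ∧ u (n + 1) < x ^ 2 - 2 := by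
    have h₁ : 0 < x ^ 2 - 2 - u n := by linarith [h.2]
    have h₂ : 0 < 4 - x ^ 2 + (x ^ 2 - 2 - u n) := by linarith
    have h₃ : 4 - x ^ 2 + (x ^ 2 - 2 - u n) < 1 := by linarith [h.1]
    have h₄ := hrec n
    have h₅ := mul_pos h₁ h₂
    have h₆ := mul_lt_of_lt_one_right h₁ h₃
    constructor <;> linarith
  have hmem (n : ℕ) : u n ∈ Set.Ioo (x ^ 2 - 9 / 4) (x ^ 2 - 2) := by
    induction n with
    | zero => exact h₀
    | succ n ih => exact ⟨ih.1.trans (hstep n ih).1, (hstep n ih).2⟩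
  exact ⟨hmem, strictMono_nat_of_lt_succ fun n => (hstep n (hmem n)).1⟩

open Polynomial in
/-- The values of the recursion stay in the number field generated by `x` and `u 0`, which contains
only finitely many sums of a root of unity and its inverse. -/
theorem exists_forall_eval_dickson_ne_of_trace_recursion {x : ℝ} {u : ℕ → ℝ}
    (hx : IsIntegral ℤ x) (h₀ : IsIntegral ℤ (u 0)) (hinj : Function.Injective u)
    (hu : ∀ n, u (n + 1) = u n * (x ^ 2 - u n) - x ^ 2 + 2) :
    ∃ n, ∀ m : ℕ, m ≠ 0 → (dickson 1 (1 : ℝ) m).eval (u n) ≠ 2 := by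
  by_contra! h
  let K := IntermediateField.adjoin ℚ {x, u 0}
  have : FiniteDimensional ℚ K :=
    IntermediateField.finiteDimensional_adjoin_pair hx.tower_top h₀.tower_top
  have : NumberField K := ⟨⟩
  have hxK : x ∈ K := IntermediateField.subset_adjoin _ _ (by simp)
  have huK (n : ℕ) : u n ∈ K := by
    induction n with
    | zero => exact IntermediateField.subset_adjoin _ _ (by simp)
    | succ n ih =>
      rw [hu]
      exact add_mem (sub_mem (mul_mem ih (sub_mem (pow_mem hxK 2) ih)) (pow_mem hxK 2))
        (ofNat_mem K 2)
  refine Set.infinite_of_injective_forall_mem (f := fun n => (⟨u n, huK n⟩ : K))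
    (fun i j hij => hinj (congrArg Subtype.val hij)) (fun n => ?_)
    (NumberField.finite_setOf_eval_dickson K)
  obtain ⟨m, hm, hmn⟩ := h n
  refine ⟨m, hm, Subtype.val_injective ?_⟩
  exact (eval_map_dickson_one_one (algebraMap K ℝ) m ⟨u n, huK n⟩).symm.trans hmn

/-- Every dense subgroup of `PSL₂(ℝ)` contains an elliptic element of infinite order. -/
theorem dense_subgroup_contains_elliptic_of_infinite_order (G : Subgroup PSL2R)
    (hG : Dense (G : Set PSL2R)) :
    ∃ g ∈ G, IsElliptic g ∧ ¬ IsOfFinOrder g := by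
  by_contra! h
  let H := G.comap (QuotientGroup.mk' (Subgroup.center (SpecialLinearGroup (Fin 2) ℝ)))
  have hH : Dense (H : Set (SpecialLinearGroup (Fin 2) ℝ)) :=
    hG.preimage QuotientGroup.isOpenMap_coe
  have hdickson {A : SpecialLinearGroup (Fin 2) ℝ} (hA : A ∈ H) (htr : |trace A.1| < 2) :=
    SpecialLinearGroup.eval_dickson_trace_of_isOfFinOrder_mk (h _ hA ⟨A, rfl, htr⟩)
  obtain ⟨A, ⟨hA, hA'⟩, hAH⟩ := hH.inter_open_nonempty _
    ((isOpen_Ioo (a := (15 / 4 : ℝ)) (b := 4)).preimage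
      (SpecialLinearGroup.continuous_val_real.matrix_trace.pow 2)) (by
      obtain ⟨A, hA⟩ := SpecialLinearGroup.exists_trace_eq (39 / 20)
      exact ⟨A, by simp only [Set.mem_preimage, Pi.pow_apply, hA]; norm_num⟩)
  simp only [Pi.pow_apply] at hA hA'
  obtain ⟨B, hB, hBH⟩ := hH.inter_open_nonempty _
    ((isOpen_Ioo (a := trace A.1 ^ 2 - 9 / 4) (b := trace A.1 ^ 2 - 2)).preimage
      (SpecialLinearGroup.continuous_trace_mul_conj A)) (by
      obtain ⟨B, hB⟩ := SpecialLinearGroup.exists_trace_mul_conj_eq hA' (p := 1 / 8) (by norm_num)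
      exact ⟨B, by simp only [Set.mem_preimage, hB]; constructor <;> linarith⟩)
  let u (n : ℕ) : ℝ := trace (A * SpecialLinearGroup.iterConj A B n).1
  have hu := SpecialLinearGroup.trace_mul_iterConj_succ A B
  obtain ⟨hmem, hmono⟩ := mem_Ioo_and_strictMono_of_trace_recursion (u := u) hA hA' hB hu
  have hdu (n : ℕ) := hdickson (H.mul_mem hAH (SpecialLinearGroup.iterConj_mem hAH hBH n)) (by
    rw [abs_lt]
    constructor <;> linarith [(hmem n).1, (hmem n).2])
  obtain ⟨m, hm, hmA⟩ := hdickson hAH (abs_lt_of_sq_lt_sq (by linarith) (by norm_num))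
  obtain ⟨k, hk, hku⟩ := hdu 0
  obtain ⟨n, hn⟩ := exists_forall_eval_dickson_ne_of_trace_recursion (u := u)
    (Real.isIntegral_of_eval_dickson hm hmA) (Real.isIntegral_of_eval_dickson hk hku)
    hmono.injective hu
  obtain ⟨l, hl, hlu⟩ := hdu n
  exact hn l hl hlu
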